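/- Let J₀ ∈ ℤ and let N_j (j ≥ J₀) be d×d real-valued invertible matrices such that Λ := ∪_{j≥J₀} N_j^{-1}ℤ^d has no accumulation point and lim_{j→+∞} ‖N_j k‖ = 0 for all k ∈ Λ. Let Φ_j, Φ̃_j, Ψ_j, Ψ̃_j (as in the equivalence of Theorem 3.5) be finite subsets of locally square-integrable functions for all j ≥ J₀. Then (FWS_J(Φ_J;{Ψ_j}_{j≥J}), FWS_J(Φ̃_J;{Ψ̃_j}_{j≥J})) is a pair of frequency-based nonstationary dual wavelet frames in D'(ℝ^d) for every integer J ≥ J₀ if and only if: (a) lim_{j→+∞} ⟨ Σ_{ℓ=1}^{r_j} \overline{φ^{j,ℓ}(N_j·)} φ̃^{j,ℓ}(N_j·), h ⟩ = ⟨1, h⟩ for all compactly supported C^∞ functions h; and (b) for all j ≥ J₀ and all k ∈ N_j^{-1}ℤ^d ∪ N_{j+1}^{-1}ℤ^d, I^{N_j k}_{Φ_j}(N_j ξ) + I^{N_j k}_{Ψ_j}(N_j ξ) = I^{N_{j+1} k}_{Φ_{j+1}}(N_{j+1} ξ) for a.e. ξ ∈ ℝ^d. -/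

import Mathlib

open MeasureTheory Filter Complex Topology
open scoped Real

noncomputable section

/-- Complex-valued functions on `ℝ^d`. -/
abbrev CF (d : ℕ) := (Fin d → ℝ) → ℂ

/-- An integer vector regarded as a real vector. -/
def iv {d : ℕ} (k : Fin d → ℤ) : Fin d → ℝ := fun i => (k i : ℝ)

/-- `f_{U;k}(x) = |det U|^{1/2} f(Ux - k)`. -/
def wdil {d : ℕ} (U : Matrix (Fin d) (Fin d) ℝ) (k : Fin d → ℤ) (f : CF d) : CF d :=
  fun x => (Real.sqrt |U.det| : ℂ) * f (U.mulVec x - iv k)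

/-- The `L²` inner product `⟨f,g⟩ = ∫ f · conj g`. -/
def ip {d : ℕ} (f g : CF d) : ℂ := ∫ x, f x * (starRingEnd ℂ) (g x)

/-- The squared `L²` norm. -/
def nsq {d : ℕ} (f : CF d) : ℝ := ∫ x, ‖f x‖ ^ 2

/-- All complex eigenvalues have modulus greater than one. -/
def Expansive {d : ℕ} (M : Matrix (Fin d) (Fin d) ℝ) : Prop :=
  ∀ μ ∈ spectrum ℂ (M.map (Complex.ofReal : ℝ → ℂ)), 1 < ‖μ‖

/-- Real dot product on `ℝ^d`. -/
def dotR {d : ℕ} (x y : Fin d → ℝ) : ℝ := ∑ i, x i * y i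

/-- The frequency-based dilation `h_{U;0,k}(x) = |det U|^{1/2} e^{-i k·Ux} h(Ux)`. -/
def fdil {d : ℕ} (U : Matrix (Fin d) (Fin d) ℝ) (k : Fin d → ℤ) (f : CF d) : CF d :=
  fun x => (Real.sqrt |U.det| : ℂ) *
    Complex.exp (-Complex.I * (dotR (iv k) (U.mulVec x) : ℝ)) * f (U.mulVec x)

/-- `f` is locally square integrable on `ℝ^d`. -/
def LocL2 {d : ℕ} (f : CF d) : Prop :=
  ∀ K : Set (Fin d → ℝ), IsCompact K → MemLp f 2 (volume.restrict K)

/-- `f` is a compactly supported `C^∞` test function. -/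
def IsTest {d : ℕ} (f : CF d) : Prop := ContDiff ℝ (⊤ : ℕ∞) f ∧ HasCompactSupport f

/-- `(FWS_J(Φ;{Ψ_j}), FWS_J(Φ̃;{Ψ̃_j}))` is a pair of frequency-based nonstationary dual
wavelet frames in the distribution space `D'(ℝ^d)`: for all test functions `f, g`, all the
level-wise series converge absolutely, and the partial sums up to level `J'-1` converge to
`(2π)^d ⟨f,g⟩` as `J' → +∞`. -/
def DualDistr {d : ℕ} (N : ℤ → Matrix (Fin d) (Fin d) ℝ) (J : ℤ)
    {ιΦ : Type} (Φ Φt : ιΦ → CF d)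
    {ι : ℤ → Type} (Ψ Ψt : (j : ℤ) → ι j → CF d) : Prop :=
  ∀ f g : CF d, IsTest f → IsTest g →
    Summable (fun p : ιΦ × (Fin d → ℤ) =>
      ip f (fdil (N J) p.2 (Φ p.1)) * ip (fdil (N J) p.2 (Φt p.1)) g) ∧
    (∀ j : ℤ, J ≤ j → Summable (fun p : ι j × (Fin d → ℤ) =>
      ip f (fdil (N j) p.2 (Ψ j p.1)) * ip (fdil (N j) p.2 (Ψt j p.1)) g)) ∧
    Tendsto (fun n : ℕ =>
        (∑' p : ιΦ × (Fin d → ℤ),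
          ip f (fdil (N J) p.2 (Φ p.1)) * ip (fdil (N J) p.2 (Φt p.1)) g)
        + ∑ m ∈ Finset.range n, ∑' p : ι (J + (m : ℤ)) × (Fin d → ℤ),
            ip f (fdil (N (J + (m : ℤ))) p.2 (Ψ (J + (m : ℤ)) p.1)) *
              ip (fdil (N (J + (m : ℤ))) p.2 (Ψt (J + (m : ℤ)) p.1)) g)
      atTop (𝓝 ((((2 * π) ^ d : ℝ) : ℂ) * ip f g))

/-- The frame sum of the frequency-based nonstationary system `FWS_J(Φ;{Ψ_j})`. -/
def nsSum {d : ℕ} (N : ℤ → Matrix (Fin d) (Fin d) ℝ) (J : ℤ)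
    {ιΦ : Type} (Φ : ιΦ → CF d) {ι : ℤ → Type} (Ψ : (j : ℤ) → ι j → CF d)
    (f : CF d) : ℝ :=
  (∑' p : ιΦ × (Fin d → ℤ), ‖ip f (fdil (N J) p.2 (Φ p.1))‖ ^ 2)
    + ∑' (n : ℕ), ∑' p : ι (J + (n : ℤ)) × (Fin d → ℤ),
        ‖ip f (fdil (N (J + (n : ℤ))) p.2 (Ψ (J + (n : ℤ)) p.1))‖ ^ 2

open scoped Classical in
/-- The bracket product `I^k_Φ(ξ) = Σ_ℓ conj(φ^ℓ(ξ)) φ̃^ℓ(ξ+2πk)` for `k ∈ ℤ^d`,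
defined to be `0` for `k ∈ ℝ^d ∖ ℤ^d`. -/
def Ipair {d : ℕ} {ι : Type} [Fintype ι] (φ φt : ι → CF d)
    (k : Fin d → ℝ) (ξ : Fin d → ℝ) : ℂ :=
  if ∀ i, ∃ m : ℤ, k i = (m : ℝ) then
    ∑ ℓ, (starRingEnd ℂ) (φ ℓ ξ) * φt ℓ (ξ + (2 * π) • k)
  else 0


section Parseval

@[reducible] def torusMS : MeasureSpace UnitAddCircle := ⟨AddCircle.haarAddCircle⟩
attribute [local instance] torusMS

def Q01 (d : ℕ) : Set (Fin d → ℝ) := {x | ∀ i, x i ∈ Set.Ioc (0:ℝ) (0+1)}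

lemma measQ (d : ℕ) : MeasurableSet (Q01 d) := by
  exact MeasurableSet.univ_pi' (fun i => measurableSet_Ioc)

/-- the character -/
def ech {d : ℕ} (n : Fin d → ℤ) (x : Fin d → ℝ) : ℂ :=
  Complex.exp (2 * π * Complex.I * (dotR (iv n) x : ℝ))

lemma ech_eq {d : ℕ} (n : Fin d → ℤ) (x : Fin d → ℝ) :
    UnitAddTorus.mFourier n (fun i => (x i : UnitAddCircle)) = ech n x := by
  simp only [UnitAddTorus.mFourier, ContinuousMap.coe_mk, fourier_coe_apply, ech, dotR, iv]
  rw [← Complex.exp_sum]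
  congr 1
  push_cast
  rw [Finset.mul_sum]
  refine Finset.sum_congr rfl fun i _ => ?_
  ring

def liftT {d : ℕ} (F : CF d) : UnitAddTorus (Fin d) → ℂ :=
  fun x => F (UnitAddTorus.measurableEquivPiIoc (fun _ : Fin d => (0:ℝ)) x).1

lemma liftT_coe {d : ℕ} (F : CF d) {x : Fin d → ℝ} (hx : x ∈ Q01 d) :
    liftT F (fun i => (x i : UnitAddCircle)) = F x := by
  have : (fun i => (x i : UnitAddCircle)) =
      (UnitAddTorus.measurableEquivPiIoc (fun _ : Fin d => (0:ℝ))).symm ⟨x, hx⟩ := rfl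
  rw [this, liftT, MeasurableEquiv.apply_symm_apply]

lemma liftT_memLp {d : ℕ} {F : CF d} (hF : MemLp F 2 (volume.restrict (Q01 d))) :
    MemLp (liftT F) 2 (volume : Measure (UnitAddTorus (Fin d))) := by
  refine hF.comp_measurePreserving (f := fun x =>
    (UnitAddTorus.measurableEquivPiIoc (fun _ : Fin d => (0:ℝ)) x).1) ?_
  exact (measurePreserving_subtype_coe (measQ d)).comp
    (UnitAddTorus.measurePreserving_equivPiIoc (fun _ : Fin d => (0:ℝ)))

lemma liftT_coeff {d : ℕ} {F : CF d} (hF : MemLp F 2 (volume.restrict (Q01 d))) (n : Fin d → ℤ) :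
    UnitAddTorus.mFourierCoeff ((liftT_memLp hF).toLp (liftT F)) n =
      ∫ x in Q01 d, ech (-n) x * F x := by
  have h1 : UnitAddTorus.mFourierCoeff ((liftT_memLp hF).toLp (liftT F)) n =
      UnitAddTorus.mFourierCoeff (liftT F) n := by
    refine integral_congr_ae ?_
    filter_upwards [(liftT_memLp hF).coeFn_toLp] with t ht
    rw [ht]
  rw [h1, UnitAddTorus.mFourierCoeff_eq_integral _ _ (fun _ => 0)]
  refine setIntegral_congr_fun (measQ d) fun x hx => ?_
  simp only [smul_eq_mul]
  rw [ech_eq, liftT_coe F hx]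

lemma parsevalQ {d : ℕ} {F G : CF d} (hF : MemLp F 2 (volume.restrict (Q01 d)))
    (hG : MemLp G 2 (volume.restrict (Q01 d))) :
    HasSum (fun n : Fin d → ℤ => (starRingEnd ℂ) (∫ x in Q01 d, ech (-n) x * F x) *
      (∫ x in Q01 d, ech (-n) x * G x)) (∫ x in Q01 d, (starRingEnd ℂ) (F x) * G x) := by
  have h := UnitAddTorus.hasSum_prod_mFourierCoeff ((liftT_memLp hF).toLp (liftT F))
    ((liftT_memLp hG).toLp (liftT G))
  convert h using 1
  · funext n
    exact congrArg₂ (fun a b => (starRingEnd ℂ) a * b) (liftT_coeff hF n).symm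
      (liftT_coeff hG n).symm
  have h1 : ∫ t, (starRingEnd ℂ) ((liftT_memLp hF).toLp (liftT F) t) *
      ((liftT_memLp hG).toLp (liftT G) t) = ∫ t, (starRingEnd ℂ) (liftT F t) * liftT G t := by
    refine integral_congr_ae ?_
    filter_upwards [(liftT_memLp hF).coeFn_toLp, (liftT_memLp hG).coeFn_toLp] with t ht ht'
    rw [ht, ht']
  refine Eq.trans ?_ h1.symm
  rw [UnitAddTorus.integral_preimage _ (fun _ => 0)]
  refine setIntegral_congr_fun (measQ d) fun x hx => ?_
  rw [liftT_coe F hx, liftT_coe G hx]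

end Parseval

section Fold

def cell {d : ℕ} (x : Fin d → ℝ) : Fin d → ℤ := fun i => ⌈x i⌉ - 1

lemma sub_cell_mem {d : ℕ} (x : Fin d → ℝ) : x - iv (cell x) ∈ Q01 d := by
  intro i
  simp only [Pi.sub_apply, iv, cell, Int.cast_sub, Int.cast_one, Set.mem_Ioc]
  constructor
  · linarith [Int.ceil_lt_add_one (x i)]
  · linarith [Int.le_ceil (x i)]

lemma cell_unique {d : ℕ} {x : Fin d → ℝ} {m : Fin d → ℤ} (h : x - iv m ∈ Q01 d) :
    m = cell x := by
  funext i
  have := h i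
  simp only [Pi.sub_apply, iv, Set.mem_Ioc] at this
  have h2 : ⌈x i⌉ = m i + 1 := by
    rw [Int.ceil_eq_iff]
    push_cast
    constructor <;> linarith [this.1, this.2]
  simp [cell, h2]

lemma cell_add {d : ℕ} {x : Fin d → ℝ} {m : Fin d → ℤ} (h : x ∈ Q01 d) :
    cell (x + iv m) = m := by
  symm
  apply cell_unique
  simpa using h

lemma iv_add {d : ℕ} (m n : Fin d → ℤ) : iv (m + n) = iv m + iv n := by
  funext i; simp [iv]

/-- unfolding an integral -/
lemma fold_integral {d : ℕ} {h : CF d} (hh : Integrable h) (T : Finset (Fin d → ℤ))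
    (hT : ∀ x, h x ≠ 0 → cell x ∈ T) :
    ∫ x, h x = ∑ m ∈ T, ∫ x in Q01 d, h (x + iv m) := by
  have hpre : ∀ m : Fin d → ℤ, MeasurableSet ((fun x : Fin d → ℝ => x - iv m) ⁻¹' (Q01 d)) :=
    fun m => (measQ d).preimage (measurable_id.sub_const _)
  have h1 : ∫ x, h x = ∫ x in ⋃ m ∈ T, ((fun x : Fin d → ℝ => x - iv m) ⁻¹' (Q01 d)), h x := by
    symm
    apply setIntegral_eq_integral_of_forall_compl_eq_zero
    intro x hx
    by_contra hne
    apply hx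
    simp only [Set.mem_iUnion]
    exact ⟨cell x, hT x hne, sub_cell_mem x⟩
  rw [h1, integral_biUnion_finset T (fun m _ => hpre m)]
  · refine Finset.sum_congr rfl fun m _ => ?_
    have hmp : MeasurePreserving (fun x : Fin d → ℝ => x - iv m) volume volume :=
      measurePreserving_sub_right volume (iv m)
    have := hmp.setIntegral_preimage_emb (MeasurableEquiv.subRight (iv m)).measurableEmbedding
      (fun x => h (x + iv m)) (Q01 d)
    simpa using this
  · intro m _ m' _ hne
    rw [Function.onFun, Set.disjoint_left]
    intro x hx hx'
    exact hne ((cell_unique hx).trans (cell_unique hx').symm)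
  · intro m _
    exact hh.integrableOn

lemma ech_norm {d : ℕ} (n : Fin d → ℤ) (x : Fin d → ℝ) : ‖ech n x‖ = 1 := by
  rw [ech, show (2 * π * Complex.I * (dotR (iv n) x : ℝ) : ℂ) =
    ((2 * π * dotR (iv n) x : ℝ) : ℂ) * Complex.I by push_cast; ring]
  exact Complex.norm_exp_ofReal_mul_I _

lemma ech_cont {d : ℕ} (n : Fin d → ℤ) : Continuous (ech n) := by
  unfold ech dotR
  fun_prop

lemma ech_shift {d : ℕ} (n m : Fin d → ℤ) (x : Fin d → ℝ) : ech n (x + iv m) = ech n x := by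
  unfold ech
  rw [Complex.exp_eq_exp_iff_exists_int]
  refine ⟨∑ i, n i * m i, ?_⟩
  simp only [dotR, iv, Pi.add_apply]
  push_cast
  simp only [mul_add, Finset.sum_add_distrib]
  ring

lemma ech_mul_int {d : ℕ} (n : Fin d → ℤ) {F : CF d} (hF : Integrable F) :
    Integrable (fun x => ech n x * F x) := by
  refine hF.bdd_mul (c := 1) (ech_cont n).aestronglyMeasurable ?_
  exact Eventually.of_forall fun x => (ech_norm n x).le

lemma cell_finite {d : ℕ} {K : Set (Fin d → ℝ)} (hK : Bornology.IsBounded K) :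
    (cell '' K).Finite := by
  obtain ⟨R, hR⟩ := hK.exists_norm_le
  refine (Set.Finite.pi' (fun _ : Fin d => Set.finite_Icc (⌈-R⌉ - 1) (⌈R⌉ - 1))).subset ?_
  rintro _ ⟨x, hx, rfl⟩ i
  have := (norm_le_pi_norm x i).trans (hR x hx)
  rw [Real.norm_eq_abs, abs_le] at this
  have h1 := Int.ceil_mono this.1
  have h2 := Int.ceil_mono this.2
  simp only [cell, Set.mem_Icc]
  omega

lemma memLp_shift {d : ℕ} {F : CF d} (hF : MemLp F 2 volume) (v : Fin d → ℝ) :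
    MemLp (fun x => F (x + v)) 2 volume :=
  hF.comp_measurePreserving (measurePreserving_add_right volume v)

lemma mul_int {d : ℕ} {F G : CF d} (hF : MemLp F 2 volume) (hG : MemLp G 2 volume) :
    Integrable (fun x => (starRingEnd ℂ) (F x) * G x) :=
  MemLp.integrable_mul (p := 2) (q := 2) hF.star hG

lemma parsevalR {d : ℕ} {F G : CF d} (hF : MemLp F 2 volume) (hG : MemLp G 2 volume)
    (hFc : HasCompactSupport F) (hGc : HasCompactSupport G) (hFi : Integrable F)
    (hGi : Integrable G) :
    HasSum (fun n : Fin d → ℤ => (starRingEnd ℂ) (∫ x, ech (-n) x * F x) *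
      (∫ x, ech (-n) x * G x))
      (∑' l : Fin d → ℤ, ∫ x, (starRingEnd ℂ) (F x) * G (x + iv l)) := by
  classical
  obtain ⟨T, hT⟩ : ∃ T : Finset (Fin d → ℤ), ∀ x, (F x ≠ 0 ∨ G x ≠ 0) → cell x ∈ T := by
    have := cell_finite (hFc.isCompact.isBounded.union hGc.isCompact.isBounded)
    refine ⟨this.toFinset, fun x hx => ?_⟩
    simp only [Set.Finite.mem_toFinset]
    refine ⟨x, ?_, rfl⟩
    rcases hx with hx | hx
    · exact Or.inl (subset_tsupport _ hx)
    · exact Or.inr (subset_tsupport _ hx)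
  have hsum : ∀ H : CF d, MemLp H 2 volume →
      MemLp (fun x => ∑ m ∈ T, H (x + iv m)) 2 (volume.restrict (Q01 d)) := by
    intro H hH
    exact (memLp_finsetSum T (fun m _ => memLp_shift hH (iv m))).restrict _
  have hco : ∀ H : CF d, Integrable H → (∀ x, H x ≠ 0 → cell x ∈ T) → ∀ n : Fin d → ℤ,
      ∫ x in Q01 d, ech n x * (∑ m ∈ T, H (x + iv m)) = ∫ x, ech n x * H x := by
    intro H hH hHT n
    rw [fold_integral (ech_mul_int n hH) T (fun x hx => hHT x (right_ne_zero_of_mul hx)),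
      ← integral_finsetSum]
    · simp only [ech_shift, Finset.mul_sum]
    · intro m _
      exact ((ech_mul_int n hH).comp_add_right (iv m)).integrableOn
  have key := parsevalQ (hsum F hF) (hsum G hG)
  have e1 : ∀ n : Fin d → ℤ, ∫ x in Q01 d, ech n x * (∑ m ∈ T, F (x + iv m)) =
      ∫ x, ech n x * F x := hco F hFi (fun x hx => hT x (Or.inl hx))
  have e2 : ∀ n : Fin d → ℤ, ∫ x in Q01 d, ech n x * (∑ m ∈ T, G (x + iv m)) =
      ∫ x, ech n x * G x := hco G hGi (fun x hx => hT x (Or.inr hx))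
  simp only [e1, e2] at key
  convert key using 1
  set T' : Finset (Fin d → ℤ) := (T ×ˢ T).image (fun p => p.2 - p.1) with hT'
  rw [tsum_eq_sum (s := T')]
  · have hstep : ∀ l, ∫ x, (starRingEnd ℂ) (F x) * G (x + iv l) =
        ∑ m ∈ T, ∫ x in Q01 d, (starRingEnd ℂ) (F (x + iv m)) * G (x + iv m + iv l) := by
      intro l
      refine fold_integral (mul_int hF (memLp_shift hG _)) T (fun x hx => hT x (Or.inl ?_))
      intro h0
      simp [h0] at hx
    simp only [hstep]
    have hint : ∀ l m, Integrable (fun x => (starRingEnd ℂ) (F (x + iv m)) * G (x + iv m + iv l))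
        (volume.restrict (Q01 d)) := fun l m =>
      ((mul_int hF (memLp_shift hG (iv l))).comp_add_right (iv m)).integrableOn
    have : ∀ l ∈ T', ∑ m ∈ T, ∫ x in Q01 d,
        (starRingEnd ℂ) (F (x + iv m)) * G (x + iv m + iv l) =
        ∫ x in Q01 d, ∑ m ∈ T, (starRingEnd ℂ) (F (x + iv m)) * G (x + iv m + iv l) :=
      fun l _ => (integral_finsetSum _ (fun m _ => hint l m)).symm
    rw [Finset.sum_congr rfl this, ← integral_finsetSum]
    · refine setIntegral_congr_fun (measQ d) fun x hx => ?_
      simp only [map_sum, Finset.sum_mul]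
      rw [Finset.sum_comm]
      refine Finset.sum_congr rfl fun m hm => ?_
      rw [← Finset.mul_sum]
      congr 1
      symm
      have hinj : Function.Injective (fun m' : Fin d → ℤ => m' - m) := sub_left_injective
      have h3 : ∑ m' ∈ T, G (x + iv m') = ∑ l ∈ T.image (fun m' => m' - m),
          G (x + iv m + iv l) := by
        rw [Finset.sum_image (fun a _ b _ h => hinj h)]
        refine Finset.sum_congr rfl fun m' _ => ?_
        rw [add_assoc, ← iv_add, add_sub_cancel]
      rw [h3]
      apply Finset.sum_subset
      · intro l hl
        obtain ⟨m', hm', rfl⟩ := Finset.mem_image.1 hl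
        exact Finset.mem_image.2 ⟨(m, m'), Finset.mem_product.2 ⟨hm, hm'⟩, rfl⟩
      · intro l _ hl
        by_contra hne
        apply hl
        have := hT _ (Or.inr hne)
        rw [add_assoc, ← iv_add, cell_add hx] at this
        exact Finset.mem_image.2 ⟨m + l, this, by simp⟩
    · intro l _
      exact integrable_finsetSum _ (fun m _ => hint l m)
  · intro l hl
    rw [integral_eq_zero_of_ae]
    refine Eventually.of_forall fun x => ?_
    by_contra hne
    apply hl
    have h1 : F x ≠ 0 := by
      intro h0; simp [h0] at hne
    have h2 : G (x + iv l) ≠ 0 := by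
      intro h0; simp [h0] at hne
    refine Finset.mem_image.2 ⟨(cell x, cell (x + iv l)), Finset.mem_product.2
      ⟨hT _ (Or.inl h1), hT _ (Or.inr h2)⟩, ?_⟩
    have : cell (x + iv l) = cell x + l := by
      symm; apply cell_unique
      rw [iv_add]
      simpa using sub_cell_mem x
    simp [this]

end Fold

section Level

variable {d : ℕ}

lemma map_mulVec (U : Matrix (Fin d) (Fin d) ℝ) (hU : U.det ≠ 0) :
    Measure.map (fun ξ : Fin d → ℝ => U.mulVec ξ) volume =
      ENNReal.ofReal |U.det⁻¹| • (volume : Measure (Fin d → ℝ)) := by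
  exact Real.map_matrix_volume_pi_eq_smul_volume_pi hU

lemma cont_mulVec (U : Matrix (Fin d) (Fin d) ℝ) :
    Continuous (fun ξ : Fin d → ℝ => U.mulVec ξ) := by fun_prop

def mvEquiv (U : Matrix (Fin d) (Fin d) ℝ) (hU : U.det ≠ 0) : (Fin d → ℝ) ≃ₜ (Fin d → ℝ) where
  toFun := fun ξ => U.mulVec ξ
  invFun := fun ξ => U⁻¹.mulVec ξ
  left_inv := fun ξ => by
    simp [Matrix.mulVec_mulVec, Matrix.nonsing_inv_mul _ (isUnit_iff_ne_zero.2 hU)]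
  right_inv := fun ξ => by
    simp [Matrix.mulVec_mulVec, Matrix.mul_nonsing_inv _ (isUnit_iff_ne_zero.2 hU)]
  continuous_toFun := cont_mulVec U
  continuous_invFun := cont_mulVec U⁻¹

lemma integral_mulVec (U : Matrix (Fin d) (Fin d) ℝ) (hU : U.det ≠ 0) (h : CF d) :
    ∫ ξ, h (U.mulVec ξ) = ((|U.det|⁻¹ : ℝ) : ℂ) * ∫ y, h y := by
  have := (mvEquiv U hU).measurableEmbedding.integral_map (μ := volume) h
  have h2 : Measure.map (mvEquiv U hU) volume =
      ENNReal.ofReal |U.det⁻¹| • (volume : Measure (Fin d → ℝ)) := map_mulVec U hU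
  rw [h2, integral_smul_measure] at this
  rw [show (∫ ξ, h (U.mulVec ξ)) = ∫ x, h ((mvEquiv U hU) x) from rfl, ← this,
    ENNReal.toReal_ofReal (abs_nonneg _), abs_inv]
  simp

lemma locL2_comp {φ : CF d} (hφ : LocL2 φ) (U : Matrix (Fin d) (Fin d) ℝ) (hU : U.det ≠ 0)
    (v : Fin d → ℝ) : LocL2 (fun ξ => φ (U.mulVec ξ + v)) := by
  intro K hK
  set a : (Fin d → ℝ) → (Fin d → ℝ) := fun ξ => U.mulVec ξ + v with ha
  have hac : Continuous a := (cont_mulVec U).add continuous_const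
  have hK' : IsCompact (a '' K) := hK.image hac
  have h1 : Measure.map a volume = ENNReal.ofReal |U.det⁻¹| • (volume : Measure (Fin d → ℝ)) := by
    have : a = (fun x => x + v) ∘ (fun ξ => U.mulVec ξ) := rfl
    rw [this, ← Measure.map_map (measurable_add_const v) (cont_mulVec U).measurable,
      map_mulVec U hU, Measure.map_smul, (measurePreserving_add_right volume v).map_eq]
  have h2 : Measure.map a (volume.restrict K) ≤
      ENNReal.ofReal |U.det⁻¹| • (volume.restrict (a '' K)) := by
    rw [← Measure.restrict_smul, ← h1, Measure.restrict_map hac.measurable hK'.measurableSet]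
    exact Measure.map_mono (Measure.restrict_mono (Set.subset_preimage_image a K) le_rfl)
      hac.measurable
  have h3 := ((hφ _ hK').smul_measure (c := ENNReal.ofReal |U.det⁻¹|) ENNReal.ofReal_ne_top)
  exact (h3.mono_measure h2).comp_of_map hac.aemeasurable

lemma locL2_comp0 {φ : CF d} (hφ : LocL2 φ) (U : Matrix (Fin d) (Fin d) ℝ) (hU : U.det ≠ 0) :
    LocL2 (fun ξ => φ (U.mulVec ξ)) := by
  simpa using locL2_comp hφ U hU 0

lemma locL2_locInt {φ : CF d} (hφ : LocL2 φ) : LocallyIntegrable φ := by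
  rw [locallyIntegrable_iff]
  intro K hK
  have : IsFiniteMeasure (volume.restrict K) := ⟨by simpa using hK.measure_lt_top⟩
  exact (hφ K hK).integrable one_le_two

lemma locL2_mul {φ ψ : CF d} (hφ : LocL2 φ) (hψ : LocL2 ψ) :
    LocallyIntegrable (fun ξ => (starRingEnd ℂ) (φ ξ) * ψ ξ) := by
  rw [locallyIntegrable_iff]
  intro K hK
  exact MemLp.integrable_mul (p := 2) (q := 2) (hφ K hK).star (hψ K hK)

lemma test_mul_int {f φ : CF d} (hf : Continuous f) (hfc : HasCompactSupport f)
    (hφ : LocallyIntegrable φ) : Integrable (fun ξ => f ξ * φ ξ) :=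
  hφ.integrable_smul_left_of_hasCompactSupport hf hfc

lemma test_mul_memLp {f φ : CF d} (hf : Continuous f) (hfc : HasCompactSupport f)
    (hφ : LocL2 φ) : MemLp (fun ξ => f ξ * φ ξ) 2 volume := by
  have hK : IsCompact (tsupport f) := hfc
  obtain ⟨C, hC⟩ := hfc.exists_bound_of_continuous hf
  have h1 : MemLp (fun ξ => f ξ * φ ξ) 2 (volume.restrict (tsupport f)) := by
    refine MemLp.of_le_mul (c := C) (hφ _ hK)
      (hf.aestronglyMeasurable.mul (hφ _ hK).aestronglyMeasurable) ?_
    refine Eventually.of_forall fun ξ => ?_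
    rw [norm_mul]
    gcongr
    exact hC ξ
  rw [← memLp_indicator_iff_restrict (isClosed_tsupport f).measurableSet] at h1
  have h2 : (fun ξ => f ξ * φ ξ) = (tsupport f).indicator (fun ξ => f ξ * φ ξ) := ?_
  · rw [h2]; exact h1
  funext ξ
  by_cases hξ : ξ ∈ tsupport f
  · rw [Set.indicator_of_mem hξ]
  · rw [Set.indicator_of_notMem hξ, image_eq_zero_of_notMem_tsupport hξ, zero_mul]

lemma levelSum1 (U : Matrix (Fin d) (Fin d) ℝ) (hU : U.det ≠ 0) {φ φt f g : CF d}
    (hφ : LocL2 φ) (hφt : LocL2 φt) (hf : IsTest f) (hg : IsTest g) :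
    HasSum (fun k : Fin d → ℤ => ip f (fdil U k φ) * ip (fdil U k φt) g)
      ((((2 * π) ^ d : ℝ) : ℂ) * ∑' l : Fin d → ℤ, ∫ ξ,
        f ξ * (starRingEnd ℂ) (g (ξ + (2 * π) • U⁻¹.mulVec (iv l))) *
          ((starRingEnd ℂ) (φ (U.mulVec ξ)) * φt (U.mulVec ξ + (2 * π) • iv l))) := by
  have hpi : (2 * π : ℝ) ≠ 0 := by positivity
  set V : Matrix (Fin d) (Fin d) ℝ := (2 * π)⁻¹ • U with hV
  have hVdet : V.det = ((2 * π) ^ d)⁻¹ * U.det := by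
    rw [hV, Matrix.det_smul, Fintype.card_fin, inv_pow]
  have hV0 : V.det ≠ 0 := by rw [hVdet]; positivity
  have hVi0 : V⁻¹.det ≠ 0 := by
    rw [Matrix.det_nonsing_inv, Ring.inverse_eq_inv']; exact inv_ne_zero hV0
  have hUV0 : (U * V⁻¹).det ≠ 0 := by rw [Matrix.det_mul]; exact mul_ne_zero hU hVi0
  have hVV : ∀ ξ, V⁻¹.mulVec (V.mulVec ξ) = ξ := (mvEquiv V hV0).left_inv
  have hVV' : ∀ ξ, V.mulVec (V⁻¹.mulVec ξ) = ξ := (mvEquiv V hV0).right_inv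
  have hVU : ∀ ξ, V.mulVec ξ = (2 * π)⁻¹ • U.mulVec ξ := fun ξ => by
    rw [hV, Matrix.smul_mulVec]
  have hUV : ∀ ξ, U.mulVec ξ = (2 * π) • V.mulVec ξ := fun ξ => by
    rw [hVU, smul_smul, mul_inv_cancel₀ hpi, one_smul]
  have hVinv : ∀ y, V⁻¹.mulVec y = (2 * π) • U⁻¹.mulVec y := by
    intro y
    apply (mvEquiv V hV0).injective
    change V.mulVec _ = V.mulVec _
    rw [hVV', Matrix.mulVec_smul, hVU, smul_smul, mul_inv_cancel₀ hpi, one_smul]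
    exact ((mvEquiv U hU).right_inv y).symm
  have hcs : ∀ h : CF d, HasCompactSupport h → HasCompactSupport (fun y =>
      (starRingEnd ℂ) (h (V⁻¹.mulVec y))) := by
    intro h hh
    have := hh.comp_homeomorph (mvEquiv V hV0).symm
    exact this.comp_left (g := starRingEnd ℂ) (map_zero _)
  have hct : ∀ h : CF d, Continuous h → Continuous (fun y =>
      (starRingEnd ℂ) (h (V⁻¹.mulVec y))) := by
    intro h hh
    exact Complex.continuous_conj.comp (hh.comp (cont_mulVec _))
  have hcf := hf.1.continuous
  have hcg := hg.1.continuous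
  set A : CF d := fun y => (starRingEnd ℂ) (f (V⁻¹.mulVec y)) * φ ((U * V⁻¹).mulVec y) with hA
  set G : CF d := fun y => (starRingEnd ℂ) (g (V⁻¹.mulVec y)) * φt ((U * V⁻¹).mulVec y) with hG
  have hφ' := locL2_comp0 hφ _ hUV0
  have hφt' := locL2_comp0 hφt _ hUV0
  have P := parsevalR (F := A) (G := G) (test_mul_memLp (hct f hcf) (hcs f hf.2) hφ')
    (test_mul_memLp (hct g hcg) (hcs g hg.2) hφt') ((hcs f hf.2).mul_right)
    ((hcs g hg.2).mul_right)
    (test_mul_int (hct f hcf) (hcs f hf.2) (locL2_locInt hφ'))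
    (test_mul_int (hct g hcg) (hcs g hg.2) (locL2_locInt hφt'))
  have hUVV : ∀ ξ, (U * V⁻¹).mulVec (V.mulVec ξ) = U.mulVec ξ := by
    intro ξ; rw [← Matrix.mulVec_mulVec, hVV]
  have hech : ∀ k : Fin d → ℤ, ∀ ξ, ech (-k) (V.mulVec ξ) =
      Complex.exp (-Complex.I * (dotR (iv k) (U.mulVec ξ) : ℝ)) := by
    intro k ξ
    rw [ech, hUV]
    congr 1
    have : dotR (iv k) ((2 * π) • V.mulVec ξ) = -(2 * π * dotR (iv (-k)) (V.mulVec ξ)) := by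
      simp only [dotR, iv, Pi.smul_apply, Pi.neg_apply, smul_eq_mul, Finset.mul_sum,
        ← Finset.sum_neg_distrib]
      refine Finset.sum_congr rfl fun i _ => ?_
      push_cast
      ring
    rw [this]
    push_cast
    ring
  have e1 : ∀ k : Fin d → ℤ, ip f (fdil U k φ) = (Real.sqrt |U.det| : ℂ) *
      ((|V.det|⁻¹ : ℝ) : ℂ) * (starRingEnd ℂ) (∫ x, ech (-k) x * A x) := by
    intro k
    have := integral_mulVec V hV0 (fun y => (starRingEnd ℂ) (ech (-k) y * A y))
    rw [mul_assoc, ← integral_conj, ← this, ip, ← integral_const_mul]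
    refine integral_congr_ae (Eventually.of_forall fun ξ => ?_)
    simp only [hA, hVV, hUVV, hech, fdil, map_mul, Complex.conj_conj, Complex.conj_ofReal]
    ring
  have e2 : ∀ k : Fin d → ℤ, ip (fdil U k φt) g = (Real.sqrt |U.det| : ℂ) *
      ((|V.det|⁻¹ : ℝ) : ℂ) * (∫ x, ech (-k) x * G x) := by
    intro k
    have := integral_mulVec V hV0 (fun y => (ech (-k) y * G y))
    rw [mul_assoc, ← this, ip, ← integral_const_mul]
    refine integral_congr_ae (Eventually.of_forall fun ξ => ?_)
    simp only [hG, hVV, hUVV, hech, fdil]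
    ring
  have e3 : ∀ l : Fin d → ℤ, ∫ ξ,
        f ξ * (starRingEnd ℂ) (g (ξ + (2 * π) • U⁻¹.mulVec (iv l))) *
          ((starRingEnd ℂ) (φ (U.mulVec ξ)) * φt (U.mulVec ξ + (2 * π) • iv l)) =
      ((|V.det|⁻¹ : ℝ) : ℂ) * ∫ x, (starRingEnd ℂ) (A x) * G (x + iv l) := by
    intro l
    rw [← integral_mulVec V hV0 (fun x => (starRingEnd ℂ) (A x) * G (x + iv l))]
    refine integral_congr_ae (Eventually.of_forall fun ξ => ?_)
    have h1 : V⁻¹.mulVec (V.mulVec ξ + iv l) = ξ + (2 * π) • U⁻¹.mulVec (iv l) := by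
      rw [Matrix.mulVec_add, hVV, hVinv]
    have h2 : (U * V⁻¹).mulVec (V.mulVec ξ + iv l) = U.mulVec ξ + (2 * π) • iv l := by
      rw [← Matrix.mulVec_mulVec, h1, Matrix.mulVec_add, Matrix.mulVec_smul]
      congr 2
      exact (mvEquiv U hU).right_inv _
    simp only [hA, hG, h1, h2, hVV, hUVV, map_mul, Complex.conj_conj]
    ring
  simp only [e1, e2, e3]
  rw [tsum_mul_left]
  have hs : ((Real.sqrt |U.det| : ℂ) * ((|V.det|⁻¹ : ℝ) : ℂ)) *
      ((Real.sqrt |U.det| : ℂ) * ((|V.det|⁻¹ : ℝ) : ℂ)) =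
      (((2 * π) ^ d : ℝ) : ℂ) * ((|V.det|⁻¹ : ℝ) : ℂ) := by
    norm_cast
    have hs1 : Real.sqrt |U.det| * Real.sqrt |U.det| = |U.det| :=
      Real.mul_self_sqrt (abs_nonneg _)
    have hs2 : |V.det| = ((2 * π) ^ d)⁻¹ * |U.det| := by
      rw [hVdet, abs_mul, abs_of_pos (by positivity)]
    have hs3 : |U.det| ≠ 0 := abs_ne_zero.2 hU
    have : ((2 * π) ^ d : ℝ) = |U.det| * |V.det|⁻¹ := by
      rw [hs2]; field_simp
    rw [this]
    linear_combination |V.det|⁻¹ * |V.det|⁻¹ * hs1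
  have := P.mul_left (((Real.sqrt |U.det| : ℂ) * ((|V.det|⁻¹ : ℝ) : ℂ)) *
      ((Real.sqrt |U.det| : ℂ) * ((|V.det|⁻¹ : ℝ) : ℂ)))
  rw [← mul_assoc, ← hs]
  refine this.congr_fun fun k => ?_
  ring

lemma hasSum_fin_prod {ι κ : Type} [Fintype ι] {F : ι → κ → ℂ} {a : ι → ℂ}
    (h : ∀ i, HasSum (F i) (a i)) : HasSum (fun p : ι × κ => F p.1 p.2) (∑ i, a i) := by
  have hs : Summable (fun p : ι × κ => F p.1 p.2) := by
    refine Summable.of_norm ((summable_prod_of_nonneg (fun _ => norm_nonneg _)).2 ⟨?_, ?_⟩)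
    · exact fun i => (h i).summable.norm
    · exact (hasSum_fintype _).summable
  have := hs.hasSum
  rwa [hs.tsum_prod, tsum_fintype, Finset.sum_congr rfl (fun i _ => (h i).tsum_eq)] at this

def Bx {ι : Type} [Fintype ι] (U : Matrix (Fin d) (Fin d) ℝ) (φ φt : ι → CF d) (f g : CF d)
    (x : Fin d → ℝ) : ℂ :=
  ∫ ξ, f ξ * (starRingEnd ℂ) (g (ξ + (2 * π) • x)) * Ipair φ φt (U.mulVec x) (U.mulVec ξ)

lemma isInt_iff (k : Fin d → ℝ) : (∀ i, ∃ m : ℤ, k i = (m : ℝ)) ↔ ∃ m : Fin d → ℤ, k = iv m := by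
  constructor
  · intro h
    choose m hm using h
    exact ⟨m, funext hm⟩
  · rintro ⟨m, rfl⟩ i
    exact ⟨m i, rfl⟩

lemma Ipair_of_not {ι : Type} [Fintype ι] (φ φt : ι → CF d) {k : Fin d → ℝ}
    (hk : ¬ ∃ m : Fin d → ℤ, k = iv m) (ξ) : Ipair φ φt k ξ = 0 := by
  rw [Ipair, if_neg]
  rwa [isInt_iff]

lemma Ipair_iv {ι : Type} [Fintype ι] (φ φt : ι → CF d) (m : Fin d → ℤ) (ξ) :
    Ipair φ φt (iv m) ξ = ∑ ℓ, (starRingEnd ℂ) (φ ℓ ξ) * φt ℓ (ξ + (2 * π) • iv m) := by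
  rw [Ipair, if_pos]
  rw [isInt_iff]
  exact ⟨m, rfl⟩

lemma Ipair_locInt {ι : Type} [Fintype ι] (U : Matrix (Fin d) (Fin d) ℝ) (hU : U.det ≠ 0)
    {φ φt : ι → CF d} (hφ : ∀ ℓ, LocL2 (φ ℓ)) (hφt : ∀ ℓ, LocL2 (φt ℓ)) (k : Fin d → ℝ) :
    LocallyIntegrable (fun ξ => Ipair φ φt k (U.mulVec ξ)) := by
  by_cases hk : ∃ m : Fin d → ℤ, k = iv m
  · obtain ⟨m, rfl⟩ := hk
    simp only [Ipair_iv]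
    rw [locallyIntegrable_iff]
    intro K hK
    exact integrable_finsetSum _ fun ℓ _ =>
      (locL2_mul (locL2_comp0 (hφ ℓ) U hU)
        (locL2_comp (hφt ℓ) U hU ((2 * π) • iv m))).integrableOn_isCompact hK
  · simp only [Ipair_of_not φ φt hk]
    exact locallyIntegrable_zero

lemma fg_test {f g : CF d} (hf : IsTest f) (hg : IsTest g) (v : Fin d → ℝ) :
    Continuous (fun ξ => f ξ * (starRingEnd ℂ) (g (ξ + v))) ∧
      HasCompactSupport (fun ξ => f ξ * (starRingEnd ℂ) (g (ξ + v))) := by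
  have hcf := hf.1.continuous
  have hcg := hg.1.continuous
  refine ⟨hcf.mul (Complex.continuous_conj.comp (hcg.comp (continuous_add_const v))),
    hf.2.mul_right⟩

lemma Bx_int {ι : Type} [Fintype ι] (U : Matrix (Fin d) (Fin d) ℝ) (hU : U.det ≠ 0)
    {φ φt : ι → CF d} (hφ : ∀ ℓ, LocL2 (φ ℓ)) (hφt : ∀ ℓ, LocL2 (φt ℓ)) {f g : CF d}
    (hf : IsTest f) (hg : IsTest g) (x k : Fin d → ℝ) :
    Integrable (fun ξ => f ξ * (starRingEnd ℂ) (g (ξ + x)) * Ipair φ φt k (U.mulVec ξ)) :=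
  test_mul_int (fg_test hf hg x).1 (fg_test hf hg x).2 (Ipair_locInt U hU hφ hφt k)

/-- shifts that matter -/
def relv (f g : CF d) (x : Fin d → ℝ) : Prop := ∃ ξ, f ξ ≠ 0 ∧ g (ξ + (2 * π) • x) ≠ 0

lemma Bx_ne {ι : Type} [Fintype ι] {U : Matrix (Fin d) (Fin d) ℝ} (hU : U.det ≠ 0)
    {φ φt : ι → CF d} {f g : CF d} {x : Fin d → ℝ} (h : Bx U φ φt f g x ≠ 0) :
    (∃ m : Fin d → ℤ, x = U⁻¹.mulVec (iv m)) ∧ relv f g x := by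
  constructor
  · by_contra hc
    apply h
    have : ¬ ∃ m : Fin d → ℤ, U.mulVec x = iv m := by
      rintro ⟨m, hm⟩
      apply hc
      refine ⟨m, ?_⟩
      rw [← hm]
      exact ((mvEquiv U hU).left_inv x).symm
    simp [Bx, Ipair_of_not _ _ this]
  · by_contra hc
    apply h
    rw [Bx, integral_eq_zero_of_ae]
    refine Eventually.of_forall fun ξ => ?_
    by_contra hne
    apply hc
    refine ⟨ξ, ?_, ?_⟩ <;> intro h0 <;> simp [h0] at hne

lemma levelSum {ι : Type} [Fintype ι] (U : Matrix (Fin d) (Fin d) ℝ) (hU : U.det ≠ 0)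
    {φ φt : ι → CF d} (hφ : ∀ ℓ, LocL2 (φ ℓ)) (hφt : ∀ ℓ, LocL2 (φt ℓ)) {f g : CF d}
    (hf : IsTest f) (hg : IsTest g)
    (hfin : {x | (∃ m : Fin d → ℤ, x = U⁻¹.mulVec (iv m)) ∧ relv f g x}.Finite) :
    HasSum (fun p : ι × (Fin d → ℤ) => ip f (fdil U p.2 (φ p.1)) * ip (fdil U p.2 (φt p.1)) g)
      ((((2 * π) ^ d : ℝ) : ℂ) * ∑' x, Bx U φ φt f g x) := by
  have h := hasSum_fin_prod (fun ℓ => levelSum1 U hU (hφ ℓ) (hφt ℓ) hf hg)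
  convert h using 1
  rw [← Finset.mul_sum]
  congr 1
  have hUU : ∀ y, U.mulVec (U⁻¹.mulVec y) = y := (mvEquiv U hU).right_inv
  have hinj : Function.Injective (fun l : Fin d → ℤ => U⁻¹.mulVec (iv l)) := by
    intro a b hab
    have h1 : iv a = iv b := (mvEquiv U hU).symm.injective hab
    funext i
    have := congrFun h1 i
    simpa [iv] using this
  have h1 : ∑' x, Bx U φ φt f g x = ∑' l : Fin d → ℤ, Bx U φ φt f g (U⁻¹.mulVec (iv l)) := by
    symm
    apply hinj.tsum_eq
    intro x hx
    obtain ⟨⟨m, hm⟩, -⟩ := Bx_ne hU hx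
    exact ⟨m, hm.symm⟩
  rw [h1, ← Summable.tsum_finsetSum]
  · congr 1
    funext l
    rw [Bx, ← integral_finsetSum]
    · simp only [hUU, Ipair_iv, Finset.mul_sum]
    · intro ℓ _
      refine test_mul_int (fg_test hf hg _).1 (fg_test hf hg _).2 ?_
      exact locL2_mul (locL2_comp0 (hφ ℓ) U hU) (locL2_comp (hφt ℓ) U hU _)
  · intro ℓ _
    apply summable_of_hasFiniteSupport
    refine (hfin.preimage (f := fun l : Fin d → ℤ => U⁻¹.mulVec (iv l)) hinj.injOn).subset ?_
    intro l hl
    refine ⟨⟨l, rfl⟩, ?_⟩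
    by_contra hc
    apply hl
    beta_reduce
    rw [integral_eq_zero_of_ae]
    refine Eventually.of_forall fun ξ => ?_
    by_contra hne
    apply hc
    refine ⟨ξ, ?_, ?_⟩ <;> intro h0 <;> simp [h0] at hne

end Level

section Main

variable {d : ℕ}

lemma telesc (P S : ℤ → ℂ) (J₀ : ℤ) (L : ℂ) :
    (∀ J, J₀ ≤ J → Tendsto (fun n : ℕ => P J + ∑ m ∈ Finset.range n, S (J + (m : ℤ))) atTop (𝓝 L))
      ↔ ((∀ j, J₀ ≤ j → P j + S j = P (j + 1)) ∧ Tendsto P atTop (𝓝 L)) := by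
  have tel : (∀ j, J₀ ≤ j → P j + S j = P (j + 1)) → ∀ J, J₀ ≤ J → ∀ n : ℕ,
      P J + ∑ m ∈ Finset.range n, S (J + (m : ℤ)) = P (J + n) := by
    intro h J hJ n
    induction n with
    | zero => simp
    | succ n ih =>
      rw [Finset.sum_range_succ, ← add_assoc, ih, h _ (by omega)]
      congr 1
      push_cast
      ring
  constructor
  · intro h
    have h1 : ∀ j, J₀ ≤ j → P j + S j = P (j + 1) := by
      intro j hj
      have a := (tendsto_add_atTop_iff_nat 1).2 (h j hj)
      have b := h (j + 1) (by omega)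
      have c := a.sub b
      have e : (fun n : ℕ => (P j + ∑ m ∈ Finset.range (n + 1), S (j + (m : ℤ))) -
          (P (j + 1) + ∑ m ∈ Finset.range n, S (j + 1 + (m : ℤ)))) =
          fun _ => P j + S j - P (j + 1) := by
        funext n
        rw [Finset.sum_range_succ']
        have : ∑ m ∈ Finset.range n, S (j + ((m + 1 : ℕ) : ℤ)) =
            ∑ m ∈ Finset.range n, S (j + 1 + (m : ℤ)) := by
          refine Finset.sum_congr rfl fun m _ => ?_
          congr 1
          push_cast
          ring
        rw [this]
        simp
        ring
      rw [e, sub_self] at c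
      have := tendsto_nhds_unique c tendsto_const_nhds
      exact (sub_eq_zero.1 this.symm)
    refine ⟨h1, ?_⟩
    have h2 := h J₀ le_rfl
    simp only [tel h1 J₀ le_rfl] at h2
    have h3 : Tendsto (fun j : ℤ => P (J₀ + ((j - J₀).toNat : ℤ))) atTop (𝓝 L) := by
      refine h2.comp ?_
      refine tendsto_atTop.2 fun b => ?_
      filter_upwards [eventually_ge_atTop (J₀ + b)] with j hj
      omega
    refine h3.congr' ?_
    filter_upwards [eventually_ge_atTop J₀] with j hj
    congr 1
    omega
  · rintro ⟨h1, h2⟩ J hJ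
    simp only [tel h1 J hJ]
    refine h2.comp ?_
    refine tendsto_atTop.2 fun b => ?_
    filter_upwards [eventually_ge_atTop (b - J).toNat] with n hn
    omega

lemma fin_relv {Λ : Set (Fin d → ℝ)} (hacc : ∀ x : Fin d → ℝ, ¬ AccPt x (Filter.principal Λ))
    {f g : CF d} (hf : IsTest f) (hg : IsTest g) : {x | x ∈ Λ ∧ relv f g x}.Finite := by
  by_contra hinf
  have hK : IsCompact ((fun p : (Fin d → ℝ) × (Fin d → ℝ) => (2 * π)⁻¹ • (p.2 - p.1)) ''
      (tsupport f ×ˢ tsupport g)) :=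
    (IsCompact.prod hf.2 hg.2).image (by fun_prop)
  obtain ⟨x, -, hx⟩ := Set.Infinite.exists_accPt_of_subset_isCompact hinf hK (by
    rintro x ⟨-, ξ, h1, h2⟩
    refine ⟨(ξ, ξ + (2 * π) • x), ⟨subset_tsupport _ h1, subset_tsupport _ h2⟩, ?_⟩
    have : (2 * π : ℝ) ≠ 0 := by positivity
    simp only [add_sub_cancel_left, smul_smul, inv_mul_cancel₀ this, one_smul])
  exact hacc x (hx.mono (Filter.principal_mono.2 fun y hy => hy.1))

lemma bump_test (c : Fin d → ℝ) {ε : ℝ} (hε : 0 < ε) : ∃ g : CF d, IsTest g ∧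
    (∀ x, dist x c ≤ ε → g x = 1) ∧ (∀ x, g x ≠ 0 → dist x c < 2 * ε) := by
  let b : ContDiffBump c := ⟨ε, 2 * ε, hε, by linarith⟩
  refine ⟨fun x => ((b x : ℝ) : ℂ), ⟨?_, ?_⟩, ?_, ?_⟩
  · exact Complex.ofRealCLM.contDiff.comp b.contDiff
  · exact b.hasCompactSupport.comp_left (g := fun r : ℝ => (r : ℂ)) Complex.ofReal_zero
  · intro x hx
    simp [b.one_of_mem_closedBall (x := x) hx]
  · intro x hx
    by_contra hc
    apply hx
    simp [b.zero_of_le_dist (x := x) (not_lt.1 hc)]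

lemma bump_compact {K : Set (Fin d → ℝ)} (hK : IsCompact K) : ∃ g : CF d, IsTest g ∧
    (∀ x ∈ K, g x = 1) := by
  obtain ⟨R, hR⟩ := hK.isBounded.subset_closedBall (0 : Fin d → ℝ)
  obtain ⟨g, hg, h1, -⟩ := bump_test (0 : Fin d → ℝ) (ε := max R 1) (by positivity)
  refine ⟨g, hg, fun x hx => h1 x ?_⟩
  exact le_trans (hR hx) (le_max_left _ _)

lemma limB (J₀ : ℤ) (N : ℤ → Matrix (Fin d) (Fin d) ℝ)
    (hN : ∀ j : ℤ, J₀ ≤ j → (N j).det ≠ 0)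
    (Λ : Set (Fin d → ℝ))
    (hΛ : ∀ j : ℤ, J₀ ≤ j → ∀ k : Fin d → ℤ, (N j)⁻¹.mulVec (iv k) ∈ Λ)
    (hacc : ∀ x : Fin d → ℝ, ¬ AccPt x (Filter.principal Λ))
    (hlim : ∀ x ∈ Λ, Tendsto (fun n : ℕ => ‖(N (J₀ + (n : ℤ))).mulVec x‖) atTop (𝓝 0))
    {r : ℤ → ℕ} (Φ Φt : (j : ℤ) → Fin (r j) → CF d) {f g : CF d} (hf : IsTest f) (hg : IsTest g) :
    ∀ᶠ j : ℤ in atTop, ∑' x, Bx (N j) (Φ j) (Φt j) f g x =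
      ∫ ξ, (∑ ℓ : Fin (r j), (starRingEnd ℂ) (Φ j ℓ ((N j).mulVec ξ)) *
                Φt j ℓ ((N j).mulVec ξ)) * (starRingEnd ℂ) ((starRingEnd ℂ) (f ξ) * g ξ) := by
  have hfin := fin_relv hacc hf hg
  have hlim' : ∀ x ∈ Λ, ∀ᶠ j : ℤ in atTop, ‖(N j).mulVec x‖ < 1 := by
    intro x hx
    have h1 := (hlim x hx).eventually (gt_mem_nhds one_pos)
    obtain ⟨n0, hn0⟩ := eventually_atTop.1 h1
    filter_upwards [eventually_ge_atTop (J₀ + n0)] with j hj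
    have := hn0 (j - J₀).toNat (by omega)
    rwa [show J₀ + ((j - J₀).toNat : ℤ) = j by omega] at this
  have hall : ∀ᶠ j : ℤ in atTop, ∀ x ∈ {x | x ∈ Λ ∧ relv f g x}, ‖(N j).mulVec x‖ < 1 :=
    (Filter.eventually_all_finite hfin).2 fun x hx => hlim' x hx.1
  filter_upwards [hall, eventually_ge_atTop J₀] with j hj hj0
  rw [tsum_eq_single 0]
  · rw [Bx]
    refine integral_congr_ae (Eventually.of_forall fun ξ => ?_)
    have h0 : (N j).mulVec 0 = iv (0 : Fin d → ℤ) := by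
      rw [Matrix.mulVec_zero]; funext i; simp [iv]
    have h00 : iv (0 : Fin d → ℤ) = 0 := by funext i; simp [iv]
    simp only [h0, Ipair_iv]
    simp only [h00, smul_zero, add_zero, map_mul, Complex.conj_conj]
    ring
  · intro x hx
    by_contra hne
    obtain ⟨⟨m, hm⟩, hr⟩ := Bx_ne (hN j hj0) hne
    have h1 := hj x ⟨hm ▸ hΛ j hj0 m, hr⟩
    have h2 : (N j).mulVec x = iv m := by
      rw [hm]; exact (mvEquiv (N j) (hN j hj0)).right_inv _
    apply hx
    rw [h2] at h1
    have h3 : m = 0 := by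
      funext i
      have := (norm_le_pi_norm (iv m) i).trans_lt h1
      rw [iv, Real.norm_eq_abs, ← Int.cast_abs] at this
      have h4 : |m i| < 1 := by exact_mod_cast this
      simpa using Int.abs_lt_one_iff.1 h4
    rw [hm, h3]
    have h00 : iv (0 : Fin d → ℤ) = 0 := by funext i; simp [iv]
    rw [h00, Matrix.mulVec_zero]

lemma summable_Bx {ι : Type} [Fintype ι] {U : Matrix (Fin d) (Fin d) ℝ} (hU : U.det ≠ 0)
    {φ φt : ι → CF d} {f g : CF d}
    (hfin : {x | (∃ m : Fin d → ℤ, x = U⁻¹.mulVec (iv m)) ∧ relv f g x}.Finite) :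
    Summable (Bx U φ φt f g) :=
  summable_of_hasFiniteSupport (hfin.subset fun _ hx => Bx_ne hU hx)

lemma stepA {r s r' : ℕ} {U U' : Matrix (Fin d) (Fin d) ℝ} (hU : U.det ≠ 0) (hU' : U'.det ≠ 0)
    {Λ : Set (Fin d → ℝ)}
    (hΛ : ∀ k : Fin d → ℤ, U⁻¹.mulVec (iv k) ∈ Λ) (hΛ' : ∀ k : Fin d → ℤ, U'⁻¹.mulVec (iv k) ∈ Λ)
    (hacc : ∀ x : Fin d → ℝ, ¬ AccPt x (Filter.principal Λ))
    {φ φt : Fin r → CF d} {ψ ψt : Fin s → CF d} {φ' φt' : Fin r' → CF d}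
    (hφ : ∀ ℓ, LocL2 (φ ℓ)) (hφt : ∀ ℓ, LocL2 (φt ℓ))
    (hψ : ∀ ℓ, LocL2 (ψ ℓ)) (hψt : ∀ ℓ, LocL2 (ψt ℓ))
    (hφ' : ∀ ℓ, LocL2 (φ' ℓ)) (hφt' : ∀ ℓ, LocL2 (φt' ℓ)) :
    (∀ f g : CF d, IsTest f → IsTest g → ∑' x, Bx U φ φt f g x + ∑' x, Bx U ψ ψt f g x =
      ∑' x, Bx U' φ' φt' f g x) ↔
    (∀ x : Fin d → ℝ, ((∃ m : Fin d → ℤ, x = U⁻¹.mulVec (iv m)) ∨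
         (∃ m : Fin d → ℤ, x = U'⁻¹.mulVec (iv m))) →
        ∀ᵐ ξ : Fin d → ℝ, Ipair φ φt (U.mulVec x) (U.mulVec ξ)
            + Ipair ψ ψt (U.mulVec x) (U.mulVec ξ)
          = Ipair φ' φt' (U'.mulVec x) (U'.mulVec ξ)) := by
  have fin1 : ∀ {f g : CF d}, IsTest f → IsTest g →
      {x | (∃ m : Fin d → ℤ, x = U⁻¹.mulVec (iv m)) ∧ relv f g x}.Finite := by
    intro f g hf hg
    refine (fin_relv hacc hf hg).subset ?_
    rintro x ⟨⟨m, rfl⟩, h⟩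
    exact ⟨hΛ m, h⟩
  have fin2 : ∀ {f g : CF d}, IsTest f → IsTest g →
      {x | (∃ m : Fin d → ℤ, x = U'⁻¹.mulVec (iv m)) ∧ relv f g x}.Finite := by
    intro f g hf hg
    refine (fin_relv hacc hf hg).subset ?_
    rintro x ⟨⟨m, rfl⟩, h⟩
    exact ⟨hΛ' m, h⟩
  constructor
  · intro h x₀ hx₀
    have hx₀Λ : x₀ ∈ Λ := by
      rcases hx₀ with ⟨m, rfl⟩ | ⟨m, rfl⟩
      · exact hΛ m
      · exact hΛ' m
    obtain ⟨δ, hδ, hδ'⟩ : ∃ δ > 0, ∀ y ∈ Λ, dist y x₀ < δ → y = x₀ := by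
      have := hacc x₀
      rw [accPt_iff_nhds] at this
      push Not at this
      obtain ⟨W, hW, hW'⟩ := this
      obtain ⟨δ, hδ, hs⟩ := Metric.mem_nhds_iff.1 hW
      exact ⟨δ, hδ, fun y hy hd => hW' y ⟨hs hd, hy⟩⟩
    set D : CF d := fun ξ => Ipair φ φt (U.mulVec x₀) (U.mulVec ξ)
            + Ipair ψ ψt (U.mulVec x₀) (U.mulVec ξ)
          - Ipair φ' φt' (U'.mulVec x₀) (U'.mulVec ξ) with hD
    have hDl : LocallyIntegrable D :=
      ((Ipair_locInt U hU hφ hφt _).add (Ipair_locInt U hU hψ hψt _)).sub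
        (Ipair_locInt U' hU' hφ' hφt' _)
    have hloc : ∀ ξ₀ : Fin d → ℝ, ∀ᵐ ξ : Fin d → ℝ, ξ ∈ Metric.ball ξ₀ δ → D ξ = 0 := by
      intro ξ₀
      apply IsOpen.ae_eq_zero_of_integral_contDiff_smul_eq_zero Metric.isOpen_ball
        (hDl.locallyIntegrableOn _)
      intro h0 h0s h0c h0t
      set f : CF d := fun x => (h0 x : ℂ) with hfdef
      have hf : IsTest f := ⟨Complex.ofRealCLM.contDiff.comp h0s,
        h0c.comp_left (g := fun r : ℝ => (r : ℂ)) Complex.ofReal_zero⟩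
      obtain ⟨g, hg, hg1, hg2⟩ := bump_test (ξ₀ + (2 * π) • x₀) hδ
      have hrel : ∀ x ∈ Λ, relv f g x → x = x₀ := by
        rintro x hx ⟨ξ, hξ1, hξ2⟩
        apply hδ' x hx
        have h1 : dist ξ ξ₀ < δ := h0t (subset_tsupport _ (by
          intro h00; apply hξ1; simp [hfdef, h00]))
        have h2 := hg2 _ hξ2
        rw [dist_eq_norm] at h1 h2 ⊢
        have h3 : (2 * π) • (x - x₀) = (ξ + (2 * π) • x - (ξ₀ + (2 * π) • x₀)) - (ξ - ξ₀) := by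
          rw [smul_sub]; abel
        have h4 : ‖(2 * π) • (x - x₀)‖ ≤ _ + _ := h3 ▸ norm_sub_le _ _
        rw [norm_smul, Real.norm_eq_abs, abs_of_pos Real.two_pi_pos] at h4
        have h5 : 2 * π * ‖x - x₀‖ < 3 * δ := by linarith
        have h6 : 6 * ‖x - x₀‖ ≤ 2 * π * ‖x - x₀‖ := by
          gcongr
          linarith [Real.pi_gt_three]
        linarith
      have key := h f g hf hg
      have s1 : ∑' x, Bx U φ φt f g x = Bx U φ φt f g x₀ := by
        apply tsum_eq_single
        intro x hx
        by_contra hne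
        obtain ⟨⟨m, hm⟩, hr⟩ := Bx_ne hU hne
        exact hx (hrel x (hm ▸ hΛ m) hr)
      have s2 : ∑' x, Bx U ψ ψt f g x = Bx U ψ ψt f g x₀ := by
        apply tsum_eq_single
        intro x hx
        by_contra hne
        obtain ⟨⟨m, hm⟩, hr⟩ := Bx_ne hU hne
        exact hx (hrel x (hm ▸ hΛ m) hr)
      have s3 : ∑' x, Bx U' φ' φt' f g x = Bx U' φ' φt' f g x₀ := by
        apply tsum_eq_single
        intro x hx
        by_contra hne
        obtain ⟨⟨m, hm⟩, hr⟩ := Bx_ne hU' hne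
        exact hx (hrel x (hm ▸ hΛ' m) hr)
      have I12 : Integrable (fun ξ => f ξ * (starRingEnd ℂ) (g (ξ + (2 * π) • x₀)) *
            Ipair φ φt (U.mulVec x₀) (U.mulVec ξ) +
          f ξ * (starRingEnd ℂ) (g (ξ + (2 * π) • x₀)) *
            Ipair ψ ψt (U.mulVec x₀) (U.mulVec ξ)) :=
        (Bx_int U hU hφ hφt hf hg _ _).add (Bx_int U hU hψ hψt hf hg _ _)
      rw [s1, s2, s3, ← sub_eq_zero, Bx, Bx, Bx,
        ← integral_add (Bx_int U hU hφ hφt hf hg _ _) (Bx_int U hU hψ hψt hf hg _ _),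
        ← integral_sub I12
          (Bx_int U' hU' hφ' hφt' hf hg _ _)] at key
      rw [← key]
      refine integral_congr_ae (Eventually.of_forall fun ξ => ?_)
      simp only [hD, Complex.real_smul]
      by_cases hz : h0 ξ = 0
      · simp [hfdef, hz]
      · have h1 : dist ξ ξ₀ < δ := h0t (subset_tsupport _ hz)
        rw [hg1 (ξ + (2 * π) • x₀) (by rw [dist_add_right]; exact h1.le)]
        simp only [hfdef, map_one]
        ring
    have hall : ∀ᵐ ξ : Fin d → ℝ, D ξ = 0 := by
      rw [ae_iff]
      refine measure_null_of_locally_null _ fun ξ₀ _ => ?_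
      refine ⟨{ξ | ¬ D ξ = 0} ∩ Metric.ball ξ₀ δ, ?_, ?_⟩
      · exact inter_mem_nhdsWithin _ (Metric.ball_mem_nhds _ hδ)
      · have := ae_iff.1 (hloc ξ₀)
        refine measure_mono_null ?_ this
        rintro ξ ⟨h1, h2⟩ h3
        exact h1 (h3 h2)
    filter_upwards [hall] with ξ hξ
    exact sub_eq_zero.1 hξ
  · intro h f g hf hg
    rw [← (summable_Bx hU (fin1 hf hg)).tsum_add (summable_Bx hU (fin1 hf hg))]
    congr 1
    funext x
    by_cases hx : ((∃ m : Fin d → ℤ, x = U⁻¹.mulVec (iv m)) ∨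
         (∃ m : Fin d → ℤ, x = U'⁻¹.mulVec (iv m)))
    · rw [Bx, Bx, Bx,
        ← integral_add (Bx_int U hU hφ hφt hf hg _ _) (Bx_int U hU hψ hψt hf hg _ _)]
      refine integral_congr_ae ?_
      filter_upwards [h x hx] with ξ hξ
      rw [← hξ]
      ring
    · push Not at hx
      have z : ∀ {n : ℕ} {W : Matrix (Fin d) (Fin d) ℝ} (_ : W.det ≠ 0) (a b : Fin n → CF d),
          (∀ m : Fin d → ℤ, x ≠ W⁻¹.mulVec (iv m)) → Bx W a b f g x = 0 := by
        intro n W hW a b hm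
        by_contra hne
        obtain ⟨⟨m, hm'⟩, -⟩ := Bx_ne hW hne
        exact hm m hm'
      rw [z hU _ _ hx.1, z hU _ _ hx.1, z hU' _ _ hx.2, add_zero]

end Main

/-- characterization of a sequence of pairs of frequency-based nonstationary
dual wavelet frames in the distribution space by the limit condition on the `Φ_j` and the
bracket-product (quasi-MRA) identities. -/
theorem statement13 {d : ℕ} (J₀ : ℤ) (N : ℤ → Matrix (Fin d) (Fin d) ℝ)
    (hNinv : ∀ j : ℤ, J₀ ≤ j → IsUnit (N j).det)
    (Λ : Set (Fin d → ℝ))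
    (hΛ : Λ = {x : Fin d → ℝ | ∃ j : ℤ, J₀ ≤ j ∧ ∃ k : Fin d → ℤ,
      x = (N j)⁻¹.mulVec (iv k)})
    (hacc : ∀ x : Fin d → ℝ, ¬ AccPt x (Filter.principal Λ))
    (hlim : ∀ x ∈ Λ, Tendsto (fun n : ℕ => ‖(N (J₀ + (n : ℤ))).mulVec x‖) atTop (𝓝 0))
    {r s : ℤ → ℕ} (Φ Φt : (j : ℤ) → Fin (r j) → CF d)
    (Ψ Ψt : (j : ℤ) → Fin (s j) → CF d)
    (hΦ : ∀ j : ℤ, J₀ ≤ j → ∀ ℓ, LocL2 (Φ j ℓ))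
    (hΦt : ∀ j : ℤ, J₀ ≤ j → ∀ ℓ, LocL2 (Φt j ℓ))
    (hΨ : ∀ j : ℤ, J₀ ≤ j → ∀ ℓ, LocL2 (Ψ j ℓ))
    (hΨt : ∀ j : ℤ, J₀ ≤ j → ∀ ℓ, LocL2 (Ψt j ℓ)) :
    (∀ J : ℤ, J₀ ≤ J → DualDistr N J (Φ J) (Φt J) Ψ Ψt) ↔
      ((∀ h : CF d, IsTest h →
        Tendsto (fun j : ℤ =>
            ∫ ξ, (∑ ℓ : Fin (r j), (starRingEnd ℂ) (Φ j ℓ ((N j).mulVec ξ)) *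
                Φt j ℓ ((N j).mulVec ξ)) * (starRingEnd ℂ) (h ξ))
          atTop (𝓝 (∫ ξ, (starRingEnd ℂ) (h ξ)))) ∧
       (∀ j : ℤ, J₀ ≤ j → ∀ x : Fin d → ℝ,
        ((∃ m : Fin d → ℤ, x = (N j)⁻¹.mulVec (iv m)) ∨
         (∃ m : Fin d → ℤ, x = (N (j + 1))⁻¹.mulVec (iv m))) →
        ∀ᵐ ξ : Fin d → ℝ,
          Ipair (Φ j) (Φt j) ((N j).mulVec x) ((N j).mulVec ξ)
            + Ipair (Ψ j) (Ψt j) ((N j).mulVec x) ((N j).mulVec ξ)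
          = Ipair (Φ (j + 1)) (Φt (j + 1)) ((N (j + 1)).mulVec x)
              ((N (j + 1)).mulVec ξ))) := by
  have hN : ∀ j : ℤ, J₀ ≤ j → (N j).det ≠ 0 := fun j hj => (hNinv j hj).ne_zero
  have hΛ' : ∀ j : ℤ, J₀ ≤ j → ∀ k : Fin d → ℤ, (N j)⁻¹.mulVec (iv k) ∈ Λ := by
    intro j hj k
    rw [hΛ]
    exact ⟨j, hj, k, rfl⟩
  have hfin : ∀ j : ℤ, J₀ ≤ j → ∀ {f g : CF d}, IsTest f → IsTest g →
      {x | (∃ m : Fin d → ℤ, x = (N j)⁻¹.mulVec (iv m)) ∧ relv f g x}.Finite := by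
    intro j hj f g hf hg
    refine (fin_relv hacc hf hg).subset ?_
    rintro x ⟨⟨m, rfl⟩, h⟩
    exact ⟨hΛ' j hj m, h⟩
  have hc : ((((2 * π) ^ d : ℝ) : ℂ)) ≠ 0 := by
    rw [Complex.ofReal_ne_zero]
    positivity
  have L1 : ∀ j : ℤ, J₀ ≤ j → ∀ {f g : CF d}, IsTest f → IsTest g → HasSum _ _ :=
    fun j hj f g hf hg => levelSum (N j) (hN j hj) (hΦ j hj) (hΦt j hj) hf hg (hfin j hj hf hg)
  have L2 : ∀ j : ℤ, J₀ ≤ j → ∀ {f g : CF d}, IsTest f → IsTest g → HasSum _ _ :=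
    fun j hj f g hf hg => levelSum (N j) (hN j hj) (hΨ j hj) (hΨt j hj) hf hg (hfin j hj hf hg)
  have E1 : (∀ J : ℤ, J₀ ≤ J → DualDistr N J (Φ J) (Φt J) Ψ Ψt) ↔
      ∀ f g : CF d, IsTest f → IsTest g →
        ((∀ j, J₀ ≤ j → ∑' x, Bx (N j) (Φ j) (Φt j) f g x + ∑' x, Bx (N j) (Ψ j) (Ψt j) f g x =
          ∑' x, Bx (N (j + 1)) (Φ (j + 1)) (Φt (j + 1)) f g x) ∧
        Tendsto (fun j => ∑' x, Bx (N j) (Φ j) (Φt j) f g x) atTop (𝓝 (ip f g))) := by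
    have T := fun f g : CF d => telesc (fun j => ∑' x, Bx (N j) (Φ j) (Φt j) f g x)
      (fun j => ∑' x, Bx (N j) (Ψ j) (Ψt j) f g x) J₀ (ip f g)
    have R : ∀ (f g : CF d), IsTest f → IsTest g → ∀ J, J₀ ≤ J → ∀ n : ℕ,
        ((∑' p : Fin (r J) × (Fin d → ℤ),
          ip f (fdil (N J) p.2 (Φ J p.1)) * ip (fdil (N J) p.2 (Φt J p.1)) g)
        + ∑ m ∈ Finset.range n, ∑' p : Fin (s (J + (m : ℤ))) × (Fin d → ℤ),
            ip f (fdil (N (J + (m : ℤ))) p.2 (Ψ (J + (m : ℤ)) p.1)) *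
              ip (fdil (N (J + (m : ℤ))) p.2 (Ψt (J + (m : ℤ)) p.1)) g) =
        (((2 * π) ^ d : ℝ) : ℂ) * (∑' x, Bx (N J) (Φ J) (Φt J) f g x +
          ∑ m ∈ Finset.range n, ∑' x, Bx (N (J + (m : ℤ))) (Ψ (J + (m : ℤ)))
            (Ψt (J + (m : ℤ))) f g x) := by
      intro f g hf hg J hJ n
      rw [(L1 J hJ hf hg).tsum_eq, mul_add, Finset.mul_sum]
      congr 1
      exact Finset.sum_congr rfl fun m _ => (L2 (J + m) (by omega) hf hg).tsum_eq
    constructor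
    · intro h f g hf hg
      refine (T f g).1 fun J hJ => ?_
      have := (h J hJ f g hf hg).2.2
      simp only [R f g hf hg J hJ] at this
      have h2 := this.const_mul ((((2 * π) ^ d : ℝ) : ℂ))⁻¹
      simp only [inv_mul_cancel_left₀ hc] at h2
      exact h2
    · intro h J hJ f g hf hg
      refine ⟨(L1 J hJ hf hg).summable, fun j hj => (L2 j (hJ.trans hj) hf hg).summable, ?_⟩
      simp only [R f g hf hg J hJ]
      exact ((T f g).2 (h f g hf hg) J hJ).const_mul _
  have SA := fun (j : ℤ) (hj : J₀ ≤ j) => stepA (hN j hj) (hN (j + 1) (by omega)) (hΛ' j hj)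
    (hΛ' (j + 1) (by omega)) hacc (hΦ j hj) (hΦt j hj) (hΨ j hj) (hΨt j hj)
    (hΦ (j + 1) (by omega)) (hΦt (j + 1) (by omega))
  have SB := fun {f g : CF d} (hf : IsTest f) (hg : IsTest g) =>
    limB J₀ N hN Λ hΛ' hacc hlim Φ Φt hf hg
  rw [E1]
  constructor
  · intro H
    refine ⟨?_, fun j hj => (SA j hj).1 fun f g hf hg => (H f g hf hg).1 j hj⟩
    intro h hh
    obtain ⟨f, hf, hf1⟩ := bump_compact (K := tsupport h) hh.2
    have h1 := ((H f h hf hh).2.congr' (SB hf hh))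
    have h2 : ∀ ξ, (starRingEnd ℂ) (f ξ) * h ξ = h ξ := by
      intro ξ
      by_cases hξ : ξ ∈ tsupport h
      · simp [hf1 ξ hξ]
      · simp [image_eq_zero_of_notMem_tsupport hξ]
    have h3 : ip f h = ∫ ξ, (starRingEnd ℂ) (h ξ) := by
      rw [ip]
      congr 1
      funext ξ
      conv_rhs => rw [← h2 ξ]
      simp
    simp only [h2] at h1
    rwa [h3] at h1
  · rintro ⟨Ha, Hb⟩ f g hf hg
    refine ⟨fun j hj => (SA j hj).2 (Hb j hj) f g hf hg, ?_⟩
    have ht : IsTest (fun ξ => (starRingEnd ℂ) (f ξ) * g ξ) := by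
      refine ⟨?_, hg.2.mul_left⟩
      exact (Complex.conjCLE.contDiff.comp hf.1).mul hg.1
    have h1 := (Ha _ ht).congr' ((SB hf hg).mono fun j hj => hj.symm)
    have h3 : ip f g = ∫ ξ, (starRingEnd ℂ) ((starRingEnd ℂ) (f ξ) * g ξ) := by
      rw [ip]
      simp
    rwa [h3]
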